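/- arXiv:1412.2022 — 9 statements merged into one kernel-verified Lean document; each statement's English description precedes it below -/
import Mathlib

section
/- Suppose Φ : (ℕ → ℕ → ℕ) → (ℕ → Bool) × ℕ satisfies: for every colouring f of pairs, the set A_f = {n | (Φ f).1 n = true} is infinite and f k l ≠ (Φ f).2 whenever k < l and both k, l lie in A_f. Then for every f, the map g ↦ (Φ g).2 is not continuous at f. (This is the set-theoretic content of the paper's Theorem that the uniform thin set theorem UTS(2) is equivalent to arithmetical comprehension: the avoided value of any uniform thin-set functional is everywhere discontinuous.) -/
/-- The avoided value of any uniform thin-set functional for pairs is everywhere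
discontinuous. -/
theorem uniform_thin_set_discontinuous
    (Φ : (ℕ → ℕ → ℕ) → (ℕ → Bool) × ℕ)
    (h : ∀ f : ℕ → ℕ → ℕ,
      {n | (Φ f).1 n = true}.Infinite ∧
      ∀ k l, k < l → (Φ f).1 k = true → (Φ f).1 l = true → f k l ≠ (Φ f).2) :
    ∀ f : ℕ → ℕ → ℕ, ¬ ContinuousAt (fun g => (Φ g).2) f := by
  intro f hf
  set c := (Φ f).2
  let g : ℕ → ℕ → ℕ → ℕ := fun n k l => if k < n ∧ l < n then f k l else c
  have hg : Filter.Tendsto g Filter.atTop (nhds f) := by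
    refine tendsto_pi_nhds.2 fun k => tendsto_pi_nhds.2 fun l => ?_
    refine tendsto_const_nhds.congr' ?_
    filter_upwards [Filter.eventually_gt_atTop k, Filter.eventually_gt_atTop l] with n hk hl
    simp [g, hk, hl]
  have hc : ∀ᶠ n in Filter.atTop, (Φ (g n)).2 = c :=
    (hf.tendsto.comp hg).eventually ((isOpen_discrete {c}).mem_nhds rfl)
  obtain ⟨n, hn⟩ := hc.exists
  obtain ⟨hinf, havoid⟩ := h (g n)
  obtain ⟨k, hk, hnk⟩ := hinf.exists_gt n
  obtain ⟨l, hl, hkl⟩ := hinf.exists_gt k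
  refine havoid k l hkl hk hl ?_
  rw [hn]
  exact if_neg fun hlt => hlt.1.not_gt hnk
end

section
/- Suppose Φ : (ℕ → ℕ → ℕ) → (ℕ → Bool) × ℕ satisfies: for every stable colouring f of pairs, the set A_f = {n | (Φ f).1 n = true} is infinite and f k l ≠ (Φ f).2 whenever k < l and both k, l lie in A_f. Then for every stable f, the restriction of the map g ↦ (Φ g).2 to the subspace of stable colourings is not continuous at f. (This is the set-theoretic content of the paper's remark that the uniform stable thin set theorem USTS(2) is also equivalent to arithmetical comprehension.) -/
/-- The colouring `f` of pairs is stable. -/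
def StableColouringN (f : ℕ → ℕ → ℕ) : Prop :=
  ∀ x, ∃ v N : ℕ, ∀ z, N ≤ z → x < z → f x z = v

/-- The colouring that agrees with `f` on pairs whose larger element is below `m` and has the
constant value `c` on all other pairs. -/
def truncateColouring (f : ℕ → ℕ → ℕ) (c m : ℕ) : ℕ → ℕ → ℕ :=
  fun k l => if l < m then f k l else c

theorem stableColouringN_truncateColouring (f : ℕ → ℕ → ℕ) (c m : ℕ) :
    StableColouringN (truncateColouring f c m) :=
  fun _ => ⟨c, m, fun _ hz _ => if_neg hz.not_gt⟩

theorem tendsto_truncateColouring (f : ℕ → ℕ → ℕ) (c : ℕ) :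
    Filter.Tendsto (truncateColouring f c) Filter.atTop (nhds f) := by
  refine tendsto_pi_nhds.2 fun k => tendsto_pi_nhds.2 fun l => ?_
  refine tendsto_const_nhds.congr' ?_
  filter_upwards [Filter.eventually_gt_atTop l] with m hm
  exact (if_pos hm).symm

/-- The avoided value of any uniform stable thin-set functional for pairs is
discontinuous at every stable colouring, as a map on the subspace of stable
colourings. -/
theorem uniform_stable_thin_set_discontinuous
    (Φ : (ℕ → ℕ → ℕ) → (ℕ → Bool) × ℕ)
    (h : ∀ f : ℕ → ℕ → ℕ, StableColouringN f →
      {n | (Φ f).1 n = true}.Infinite ∧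
      ∀ k l, k < l → (Φ f).1 k = true → (Φ f).1 l = true → f k l ≠ (Φ f).2) :
    ∀ f : {f : ℕ → ℕ → ℕ // StableColouringN f},
      ¬ ContinuousAt (fun g : {f : ℕ → ℕ → ℕ // StableColouringN f} => (Φ g.1).2) f := by
  intro f hf
  set c := (Φ f.1).2
  have hlim : Filter.Tendsto
      (fun m => (⟨truncateColouring f.1 c m, stableColouringN_truncateColouring f.1 c m⟩ :
        {f : ℕ → ℕ → ℕ // StableColouringN f})) Filter.atTop (nhds f) :=
    tendsto_subtype_rng.2 (tendsto_truncateColouring f.1 c)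
  have hev := (hf.tendsto.comp hlim).eventually (eventually_nhds_iff.2
    ⟨{c}, fun _ hx => hx, isOpen_discrete _, rfl⟩)
  obtain ⟨m, hm⟩ := hev.exists
  obtain ⟨hinf, hthin⟩ := h _ (stableColouringN_truncateColouring f.1 c m)
  obtain ⟨k, hk, -⟩ := hinf.exists_gt m
  obtain ⟨l, hl, hlt⟩ := hinf.exists_gt (max k m)
  refine hthin k l ((le_max_left k m).trans_lt hlt) hk hl ?_
  exact (if_neg ((le_max_right k m).trans hlt.le).not_gt).trans hm.symm
end

section
/- Suppose Φ : (ℕ → ℕ) → (ℕ → Bool) × ℕ satisfies: for every f : ℕ → ℕ, the set A_f = {n | (Φ f).1 n = true} is infinite and f n ≠ (Φ f).2 for every n in A_f. Then for every f, the map g ↦ (Φ g).2 is not continuous at f. (This is the set-theoretic content of the k = 1 case of the paper's Corollary that the uniform thin set theorems UTS(k) are equivalent to arithmetical comprehension.) -/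
/-- The avoided value of any uniform thin-set functional for singletons is everywhere
discontinuous. -/
theorem uniform_thin_set_one_discontinuous
    (Φ : (ℕ → ℕ) → (ℕ → Bool) × ℕ)
    (h : ∀ f : ℕ → ℕ,
      {n | (Φ f).1 n = true}.Infinite ∧
      ∀ n, (Φ f).1 n = true → f n ≠ (Φ f).2) :
    ∀ f : ℕ → ℕ, ¬ ContinuousAt (fun g => (Φ g).2) f := by
  intro f hf
  let g : ℕ → ℕ → ℕ := fun m n => if n < m then f n else (Φ f).2
  have hg : Filter.Tendsto g Filter.atTop (nhds f) := by
    refine tendsto_pi_nhds.2 fun n => tendsto_const_nhds.congr' ?_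
    filter_upwards [Filter.eventually_gt_atTop n] with m hm
    exact (if_pos hm).symm
  have hev : ∀ᶠ m in Filter.atTop, (Φ (g m)).2 = (Φ f).2 := by
    have hlim := Filter.Tendsto.comp hf hg
    rw [nhds_discrete] at hlim
    exact Filter.tendsto_pure.1 hlim
  obtain ⟨m, hm⟩ := hev.exists
  obtain ⟨n, hn, hmn⟩ := (h (g m)).1.exists_gt m
  exact (h (g m)).2 n hn ((if_neg hmn.not_gt).trans hm.symm)
end

section
/- Suppose Ψ : (ℕ → ℕ → ℕ) → (ℕ → Bool) satisfies: for every colouring f of pairs, the set A_f = {n | Ψ f n = true} is infinite and free for f, i.e. whenever k < l, both k, l lie in A_f, and f k l lies in A_f, then f k l = k or f k l = l. Then Ψ is not continuous at any point f. (This is the set-theoretic content of the paper's Corollary that the uniform free set theorem UFS(2) is equivalent to arithmetical comprehension.) -/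
open Filter Topology in
/-- Any uniform free-set functional for pairs is everywhere discontinuous. -/
theorem uniform_free_set_discontinuous
    (Ψ : (ℕ → ℕ → ℕ) → (ℕ → Bool))
    (h : ∀ f : ℕ → ℕ → ℕ,
      {n | Ψ f n = true}.Infinite ∧
      ∀ k l, k < l → Ψ f k = true → Ψ f l = true → Ψ f (f k l) = true →
        f k l = k ∨ f k l = l) :
    ∀ f : ℕ → ℕ → ℕ, ¬ ContinuousAt Ψ f := by
  intro f hf
  obtain ⟨a, ha⟩ := (h f).1.nonempty
  -- The colourings `g N` agree with `f` on `k < N` and take the constant value `a` elsewhere.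
  let g : ℕ → ℕ → ℕ → ℕ := fun N k l => if k < N then f k l else a
  have hg : Tendsto g atTop (𝓝 f) := by
    refine tendsto_pi_nhds.2 fun k => tendsto_pi_nhds.2 fun l => ?_
    refine tendsto_const_nhds.congr' ?_
    filter_upwards [eventually_gt_atTop k] with N hN
    simp [g, hN]
  have hΨ : Tendsto (fun N => Ψ (g N) a) atTop (𝓝 (Ψ f a)) :=
    tendsto_pi_nhds.1 (hf.tendsto.comp hg) a
  rw [nhds_discrete, tendsto_pure] at hΨ
  obtain ⟨N, hN⟩ := hΨ.exists
  obtain ⟨k, hk, hNk⟩ := (h (g N)).1.exists_gt (max N a)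
  obtain ⟨l, hl, hkl⟩ := (h (g N)).1.exists_gt k
  have hNk' : N < k ∧ a < k := max_lt_iff.1 hNk
  have hgkl : g N k l = a := if_neg (by omega)
  have key := (h (g N)).2 k l hkl hk hl (by rw [hgkl, hN]; exact ha)
  rw [hgkl] at key
  omega
end

section
/- There is no function Φ : (ℕ → ℕ → Bool) × ((ℕ → ℕ) → ℕ) → ℕ × ℕ such that: (i) for every relation code X coding a linear order on its field and every g : (ℕ → ℕ) → ℕ, IF every sequence x : ℕ → ℕ taking values in the field of X admits n ≤ g x with X (x n) (x (n+1)) = true and k ≤ g x with X (x (k+1)) (x k) = true, THEN every p in the field of X satisfies X (Φ(X, g)).1 p = true and X p (Φ(X, g)).2 = true; and (ii) for every g, the map X ↦ Φ(X, g) is continuous. (This is the set-theoretic content of the paper's Theorem that the uniform contraposition UADS₂ of the ascending/descending sequence principle is equivalent to arithmetical comprehension.) -/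
/-- `X` codes a linear order on its field `{x | X x x = true}`. -/
def LinOrderOnFieldCode (X : ℕ → ℕ → Bool) : Prop :=
  (∀ x y, X x y = true → X x x = true ∧ X y y = true) ∧
  (∀ x y z, X x y = true → X y z = true → X x z = true) ∧
  (∀ x y, X x y = true → X y x = true → x = y) ∧
  (∀ x y, X x x = true → X y y = true → X x y = true ∨ X y x = true)

/-- The order with field `{0, m}` and `0 ≤ m`. -/
def pairOrder (m x y : ℕ) : Bool :=
  decide ((x = 0 ∨ x = m) ∧ (y = 0 ∨ y = m) ∧ x ≤ y)

lemma pairOrder_eq_true {m x y : ℕ} :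
    pairOrder m x y = true ↔ (x = 0 ∨ x = m) ∧ (y = 0 ∨ y = m) ∧ x ≤ y := by
  simp [pairOrder]

lemma linOrderOnFieldCode_pairOrder (m : ℕ) : LinOrderOnFieldCode (pairOrder m) := by
  simp only [LinOrderOnFieldCode, pairOrder_eq_true]
  refine ⟨?_, ?_, ?_, ?_⟩ <;> intros <;> omega

/-- A sequence in an order with two elements has a weak ascent and a weak descent among its
first two steps. -/
lemma pairOrder_exists_le_one (m : ℕ) (x : ℕ → ℕ) (hx : ∀ n, pairOrder m (x n) (x n) = true) :
    (∃ n ≤ 1, pairOrder m (x n) (x (n + 1)) = true) ∧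
      (∃ k ≤ 1, pairOrder m (x (k + 1)) (x k) = true) := by
  simp only [pairOrder_eq_true] at hx ⊢
  have h0 := hx 0
  have h1 := hx 1
  have h2 := hx 2
  constructor
  · by_cases h : x 0 ≤ x 1
    · exact ⟨0, by omega, h0.1, h1.1, h⟩
    · exact ⟨1, le_rfl, h1.1, h2.1, show x 1 ≤ x 2 by omega⟩
  · by_cases h : x 1 ≤ x 0
    · exact ⟨0, by omega, h1.1, h0.1, h⟩
    · exact ⟨1, le_rfl, h2.1, h1.1, show x 2 ≤ x 1 by omega⟩

lemma tendsto_pairOrder :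
    Filter.Tendsto pairOrder Filter.atTop (nhds (pairOrder 0)) := by
  refine tendsto_pi_nhds.2 fun x => tendsto_pi_nhds.2 fun y => ?_
  refine tendsto_const_nhds.congr' ?_
  filter_upwards [Filter.eventually_gt_atTop (x + y)] with m hm
  rw [Bool.eq_iff_iff, pairOrder_eq_true, pairOrder_eq_true]
  omega

/-- There is no uniform functional for the contraposition `UADS₂` of the
ascending/descending sequence principle that is continuous in the order for every
modulus `g`. -/
theorem no_continuous_uniform_UADS₂ :
    ¬ ∃ Φ : (ℕ → ℕ → Bool) × ((ℕ → ℕ) → ℕ) → ℕ × ℕ,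
      (∀ X : ℕ → ℕ → Bool, ∀ g : (ℕ → ℕ) → ℕ, LinOrderOnFieldCode X →
        (∀ x : ℕ → ℕ, (∀ n, X (x n) (x n) = true) →
          (∃ n ≤ g x, X (x n) (x (n + 1)) = true) ∧
          (∃ k ≤ g x, X (x (k + 1)) (x k) = true)) →
        ∀ p, X p p = true →
          X (Φ (X, g)).1 p = true ∧ X p (Φ (X, g)).2 = true) ∧
      (∀ g : (ℕ → ℕ) → ℕ, Continuous (fun X : ℕ → ℕ → Bool => Φ (X, g))) := by
  rintro ⟨Φ, hΦ, hcont⟩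
  have bounds (m : ℕ) := hΦ (pairOrder m) (fun _ => 1) (linOrderOnFieldCode_pairOrder m)
    (pairOrder_exists_le_one m)
  simp only [pairOrder_eq_true] at bounds
  have hlim := ((hcont fun _ => 1).tendsto (pairOrder 0)).comp tendsto_pairOrder
  rw [nhds_discrete, Filter.tendsto_pure] at hlim
  obtain ⟨m, hm, hpos⟩ := (hlim.and (Filter.eventually_gt_atTop 0)).exists
  simp only [Function.comp_apply] at hm
  have hm_le := (bounds m m (by simp)).2
  have h_zero := (bounds 0 0 (by simp)).2
  rw [hm] at hm_le
  omega
end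

section
/- For every h : ℕ → ℕ, the relation ≺_h is a strict linear order on ℕ (irreflexive, transitive, and any two distinct naturals are comparable), and for every sequence x : ℕ → ℕ that is either ascending for ≺_h (x n ≺_h x (n+1) for all n) or descending for ≺_h (x (n+1) ≺_h x n for all n), the sequence is ascending if and only if h k = 0 for all k. (This is the content of the paper's Remark on constructive Reverse Mathematics: the ascending/descending sequence principle ADS decides Π⁰₁-formulas.) -/
/-- `x` is `h`-small: `h k = 0` for all `k < x`. -/
def HSmall (h : ℕ → ℕ) (x : ℕ) : Prop := ∀ k < x, h k = 0

/-- The order `≺_h` on `ℕ`. -/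
def PrecH (h : ℕ → ℕ) (x y : ℕ) : Prop :=
  (HSmall h x ∧ HSmall h y ∧ x < y) ∨
  (¬ HSmall h x ∧ ¬ HSmall h y ∧ y < x) ∨
  (¬ HSmall h x ∧ HSmall h y)

/-- An `h`-small number is at most any `m` with `h m ≠ 0`. -/
theorem HSmall.le_of_ne_zero {h : ℕ → ℕ} {x m : ℕ} (hx : HSmall h x) (hm : h m ≠ 0) : x ≤ m :=
  not_lt.mp fun hlt => hm (hx m hlt)

/-- Being `h`-small is inherited upwards along `≺_h`. -/
theorem PrecH.hSmall_right {h : ℕ → ℕ} {x y : ℕ} (hxy : PrecH h x y) (hx : HSmall h x) :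
    HSmall h y := by
  unfold PrecH at hxy
  tauto

theorem PrecH.lt_of_hSmall {h : ℕ → ℕ} {x y : ℕ} (hxy : PrecH h x y) (hx : HSmall h x) :
    x < y := by
  unfold PrecH at hxy
  tauto

theorem PrecH.gt_of_not_hSmall {h : ℕ → ℕ} {x y : ℕ} (hxy : PrecH h x y) (hy : ¬ HSmall h y) :
    y < x := by
  unfold PrecH at hxy
  tauto

/-- If `≺_h` admits an infinite ascending sequence, then `h` vanishes everywhere. -/
theorem eq_zero_of_ascending {h x : ℕ → ℕ} (hx : ∀ n, PrecH h (x n) (x (n + 1))) (m : ℕ) :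
    h m = 0 := by
  by_contra hm
  by_cases hs : ∃ n, HSmall h (x n)
  · obtain ⟨n, hn⟩ := hs
    have small : ∀ k, HSmall h (x (n + k)) := fun k => by
      induction k with
      | zero => exact hn
      | succ k ih => exact (hx (n + k)).hSmall_right ih
    have mono : StrictMono fun k => x (n + k) :=
      strictMono_nat_of_lt_succ fun k => (hx (n + k)).lt_of_hSmall (small k)
    have h₁ : m + 1 ≤ x (n + (m + 1)) := mono.le_apply
    have h₂ := (small (m + 1)).le_of_ne_zero hm
    omega
  · push Not at hs
    exact not_strictAnti_of_wellFoundedLT x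
      (strictAnti_nat_of_succ_lt fun n => (hx n).gt_of_not_hSmall (hs (n + 1)))

/-- `≺_h` is a strict linear order on `ℕ`, and any sequence ascending or
descending for `≺_h` is ascending if and only if `h` vanishes everywhere. -/
theorem ADS_decides_Pi01 (h : ℕ → ℕ) :
    (∀ x, ¬ PrecH h x x) ∧
    (∀ x y z, PrecH h x y → PrecH h y z → PrecH h x z) ∧
    (∀ x y, x ≠ y → PrecH h x y ∨ PrecH h y x) ∧
    (∀ x : ℕ → ℕ,
      ((∀ n, PrecH h (x n) (x (n + 1))) ∨ (∀ n, PrecH h (x (n + 1)) (x n))) →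
      ((∀ n, PrecH h (x n) (x (n + 1))) ↔ ∀ k, h k = 0)) := by
  refine ⟨fun x hx => ?_, fun x y z hxy hyz => ?_, fun x y hne => ?_, fun x hx => ?_⟩
  · unfold PrecH at hx
    have := lt_irrefl x
    tauto
  · unfold PrecH at *
    have h₁ : x < y → y < z → x < z := lt_trans
    have h₂ : z < y → y < x → z < x := lt_trans
    tauto
  · unfold PrecH
    have := lt_or_gt_of_ne hne
    tauto
  · refine ⟨eq_zero_of_ascending, fun hz => hx.resolve_right fun hdesc => ?_⟩
    exact not_strictAnti_of_wellFoundedLT x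
      (strictAnti_nat_of_succ_lt fun n => (hdesc n).lt_of_hSmall fun k _ => hz k)
end

section
/- For every f : ℕ → ℕ → ℕ there exist an infinite set A ⊆ ℕ and a natural number n such that f k l ≠ n for all k, l ∈ A with k < l. (This is the thin set theorem TS(2), the positive content of the paper's Theorem classifying UTS(2), where arithmetical comprehension yields a uniform thin-set functional.) -/
/-- If `r k l` holds for almost all `l`, for almost all `k`, along a nontrivial filter finer than
the cofinite one, then `r` holds on all increasing pairs of some infinite set. -/
theorem exists_infinite_forall_lt_of_eventually {r : ℕ → ℕ → Prop} {F : Filter ℕ} [F.NeBot]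
    (hF : F ≤ Filter.atTop) (h : ∀ᶠ k in F, ∀ᶠ l in F, r k l) :
    ∃ A : Set ℕ, A.Infinite ∧ ∀ k ∈ A, ∀ l ∈ A, k < l → r k l := by
  obtain ⟨g, -, hg⟩ := exists_seq_of_forall_finset_exists (fun k => ∀ᶠ l in F, r k l)
    (fun k l => k < l ∧ r k l) fun s hs => by
      have hs' : ∀ᶠ l in F, ∀ k ∈ s, k < l ∧ r k l :=
        (Filter.eventually_all_finset s).2 fun k hk =>
          ((Filter.eventually_gt_atTop k).filter_mono hF).and (hs k hk)
      exact (h.and hs').exists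
  have hmono : StrictMono g := fun m n hmn => (hg m n hmn).1
  refine ⟨Set.range g, Set.infinite_range_of_injective hmono.injective, ?_⟩
  rintro _ ⟨m, rfl⟩ _ ⟨n, rfl⟩ hmn
  exact (hg m n (hmono.lt_iff_lt.1 hmn)).2

/-- The thin set theorem `TS(2)`: every colouring of pairs of naturals admits an
infinite set that omits one value. -/
theorem thin_set_theorem_two (f : ℕ → ℕ → ℕ) :
    ∃ A : Set ℕ, A.Infinite ∧ ∃ n : ℕ, ∀ k ∈ A, ∀ l ∈ A, k < l → f k l ≠ n := by
  have hF : (Filter.hyperfilter ℕ : Filter ℕ) ≤ Filter.atTop :=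
    Nat.hyperfilter_le_atTop
  by_cases h : ∀ᶠ k in (Filter.hyperfilter ℕ : Filter ℕ),
      ∀ᶠ l in (Filter.hyperfilter ℕ : Filter ℕ), f k l = 0
  · obtain ⟨A, hA, hr⟩ := exists_infinite_forall_lt_of_eventually hF h
    exact ⟨A, hA, 1, fun k hk l hl hkl => by simp [hr k hk l hl hkl]⟩
  · simp only [← Ultrafilter.eventually_not] at h
    obtain ⟨A, hA, hr⟩ := exists_infinite_forall_lt_of_eventually hF h
    exact ⟨A, hA, 0, hr⟩
end

section
/- For every f : ℕ → ℕ → ℕ there exists an infinite set A ⊆ ℕ that is free for f, i.e. for all k, l ∈ A with k < l, if f k l ∈ A then f k l = k or f k l = l. (This is the free set theorem FS(2), the positive content of the paper's Corollary classifying UFS(2), where arithmetical comprehension yields a uniform free-set functional.) -/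
/-- Along an ultrafilter, a map takes all but at most one value only on a small set. -/
theorem Ultrafilter.exists_forall_ne_eventually_ne {α β : Type*} [Nonempty β] (U : Ultrafilter α)
    (h : α → β) : ∃ c, ∀ x, x ≠ c → ∀ᶠ n in (U : Filter α), h n ≠ x := by
  by_cases hc : ∃ c, ∀ᶠ n in (U : Filter α), h n = c
  · obtain ⟨c, hc⟩ := hc
    exact ⟨c, fun x hx ↦ hc.mono fun n hn hnx ↦ hx (hnx.symm.trans hn)⟩
  · push Not at hc
    exact ⟨Classical.arbitrary β, fun x _ ↦ hc x⟩

/-- The free set theorem `FS(2)`: every colouring of pairs of naturals admits an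
infinite free set. -/
theorem free_set_theorem_two (f : ℕ → ℕ → ℕ) :
    ∃ A : Set ℕ, A.Infinite ∧
      ∀ k ∈ A, ∀ l ∈ A, k < l → f k l ∈ A → f k l = k ∨ f k l = l := by
  let U : Ultrafilter ℕ := Filter.hyperfilter ℕ
  have large (n : ℕ) : ∀ᶠ l in (U : Filter ℕ), n < l :=
    Nat.hyperfilter_le_atTop (Filter.eventually_gt_atTop n)
  choose g hg using fun k ↦ U.exists_forall_ne_eventually_ne (f k)
  obtain ⟨c, hc⟩ := U.exists_forall_ne_eventually_ne g
  let r (m l : ℕ) : Prop := m < l ∧ g m ≠ l ∧ g l ≠ m ∧ (∀ k ≤ m, f k m ≠ l) ∧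
    ∀ k ≤ m, ∀ x ≤ m, x ≠ g k → f k l ≠ x
  have ne_of_large (n : ℕ) : ∀ᶠ l in (U : Filter ℕ), n ≠ l := (large n).mono fun _ h ↦ h.ne
  have eventually_r (m : ℕ) (hm : m ≠ c) : ∀ᶠ l in (U : Filter ℕ), r m l := by
    refine (large m).and <| (ne_of_large _).and <| (hc m hm).and <| .and ?_ ?_
    · exact (Filter.eventually_all_finite (Set.finite_Iic m)).2 fun k _ ↦ ne_of_large _
    · refine (Filter.eventually_all_finite (Set.finite_Iic m)).2 fun k _ ↦
        (Filter.eventually_all_finite (Set.finite_Iic m)).2 fun x _ ↦ ?_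
      exact Filter.eventually_imp_distrib_left.2 (hg k x)
  obtain ⟨a, -, ha⟩ := exists_seq_of_forall_finset_exists (· ≠ c) r fun s hs ↦
    (((ne_of_large c).mono fun _ h ↦ h.symm).and
      ((Filter.eventually_all_finset s).2 fun m hm ↦ eventually_r m (hs m hm))).exists
  have mono : StrictMono a := fun i j hij ↦ (ha i j hij).1
  have hr {m l : ℕ} (hm : m ∈ Set.range a) (hl : l ∈ Set.range a) (h : m < l) : r m l := by
    obtain ⟨i, rfl⟩ := hm
    obtain ⟨j, rfl⟩ := hl
    exact ha i j (mono.lt_iff_lt.1 h)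
  refine ⟨Set.range a, Set.infinite_range_of_injective mono.injective, ?_⟩
  intro k hk l hl hkl hx
  by_contra! ⟨hxk, hxl⟩
  obtain hlt | hgt := hxl.lt_or_gt
  · obtain h | h := hxk.lt_or_gt
    · exact (hr hk hl hkl).2.2.2.2 k le_rfl _ h.le (hr hx hk h).2.2.1.symm rfl
    · exact (hr hx hl hlt).2.2.2.2 k h.le _ le_rfl (hr hk hx h).2.1.symm rfl
  · exact (hr hl hx hgt).2.2.2.1 k hkl.le rfl
end

section
/- For every linear order relation ≼ on ℕ (reflexive, transitive, antisymmetric, total) there exists an infinite set S ⊆ ℕ such that either every element of S has only finitely many ≼-predecessors in S, or every element of S has only finitely many ≼-successors in S; in particular, the restriction of ≼ to S is a stable linear order. (This is the cohesive ascending/descending principle CADS, the positive content of the paper's Theorem classifying UCADS, where arithmetical comprehension yields a uniform functional producing stable suborders.) -/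
/-- In the range of a sequence that is monotone for an antisymmetric relation, every element has
only finitely many predecessors. -/
theorem finite_predecessors_range {α : Type*} {s : α → α → Prop}
    (hs : ∀ x y, s x y → s y x → x = y) {g : ℕ → α} (hg : ∀ m n, m < n → s (g m) (g n)) :
    ∀ a ∈ Set.range g, {b ∈ Set.range g | s b a ∧ b ≠ a}.Finite := by
  rintro _ ⟨n, rfl⟩
  refine ((Set.finite_Iio n).image g).subset ?_
  rintro _ ⟨⟨m, rfl⟩, hmn, hne⟩
  refine ⟨m, ?_, rfl⟩
  by_contra hm
  rcases (not_lt.mp (Set.mem_Iio.not.mp hm)).eq_or_lt with rfl | hlt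
  · exact hne rfl
  · exact hne (hs _ _ hmn (hg n m hlt))


/-- The cohesive ascending/descending principle `CADS`: every linear order on `ℕ`
has an infinite subset on which it is stable: either every element has finitely
many predecessors in the subset, or every element has finitely many successors in
the subset. -/
theorem CADS (r : ℕ → ℕ → Prop)
    (hrefl : ∀ x, r x x)
    (htrans : ∀ x y z, r x y → r y z → r x z)
    (hantisymm : ∀ x y, r x y → r y x → x = y)
    (htotal : ∀ x y, r x y ∨ r y x) :
    ∃ S : Set ℕ, S.Infinite ∧
      ((∀ a ∈ S, {b ∈ S | r b a ∧ b ≠ a}.Finite) ∨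
       (∀ a ∈ S, {b ∈ S | r a b ∧ b ≠ a}.Finite)) := by
  have : IsTrans ℕ r := ⟨htrans⟩
  obtain ⟨g, hg | hg⟩ := exists_increasing_or_nonincreasing_subseq r id
  · exact ⟨Set.range g, Set.infinite_range_of_injective g.injective,
      Or.inl (finite_predecessors_range hantisymm hg)⟩
  · exact ⟨Set.range g, Set.infinite_range_of_injective g.injective,
      Or.inr (finite_predecessors_range (s := fun x y => r y x)
        (fun x y hxy hyx => hantisymm x y hyx hxy)
        fun m n hmn => (htotal _ _).resolve_left (hg m n hmn))⟩
end
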